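/- arXiv:2407.14173 — 2 statements merged into one kernel-verified Lean document; each statement's English description precedes it below -/
import Mathlib

section
/- Let (a_n)_{n=1}^N and (b_n)_{n=1}^N be complex numbers. Then ∫_0^T (∑_{n=1}^N a_n n^{-it})(∑_{n=1}^N b_n n^{it}) dt = T ∑_{n=1}^N a_n b_n + O((∑_{n=1}^N n|a_n|²)^{1/2} (∑_{n=1}^N n|b_n|²)^{1/2}), with an absolute implied constant. -/
lemma mv_int_exp (k : ℤ) : (∫ t in (0:ℝ)..(2*Real.pi), Complex.exp (Complex.I * k * t))
    = if k = 0 then 2 * (Real.pi:ℂ) else 0 := by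
  split_ifs with h
  · subst h; simp
  · have hk : (Complex.I * k) ≠ 0 := mul_ne_zero Complex.I_ne_zero (by exact_mod_cast h)
    rw [integral_exp_mul_complex hk]
    have : Complex.exp (Complex.I * k * ((2*Real.pi : ℝ):ℂ)) = 1 := by
      rw [Complex.exp_eq_one_iff]
      exact ⟨k, by push_cast; ring⟩
    rw [this]; simp

lemma mv_int_texp (k : ℤ) : (∫ t in (0:ℝ)..(2*Real.pi),
      ((t - Real.pi : ℝ) : ℂ) * Complex.exp (Complex.I * k * t))
    = 2 * Real.pi * (-Complex.I) * ((k:ℝ)⁻¹ : ℝ) := by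
  by_cases h : k = 0
  · subst h
    simp only [Int.cast_zero, mul_zero, zero_mul, Complex.exp_zero, mul_one, inv_zero, Complex.ofReal_zero]
    rw [intervalIntegral.integral_ofReal]
    simp
    ring
  · have hk0 : (k:ℂ) ≠ 0 := by exact_mod_cast h
    have hk : (Complex.I * k) ≠ 0 := mul_ne_zero Complex.I_ne_zero hk0
    have h1 : Complex.exp (Complex.I * k * ((2*Real.pi : ℝ):ℂ)) = 1 := by
      rw [Complex.exp_eq_one_iff]
      exact ⟨k, by push_cast; ring⟩
    have hd : ∀ t ∈ Set.uIcc (0:ℝ) (2*Real.pi), HasDerivAt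
        (fun t : ℝ => ((t - Real.pi : ℝ) : ℂ) * (Complex.exp (Complex.I * k * t) / (Complex.I * k))
          - Complex.exp (Complex.I * k * t) / (Complex.I * k)^2)
        (((t - Real.pi : ℝ) : ℂ) * Complex.exp (Complex.I * k * t)) t := by
      intro t _
      have e1 : HasDerivAt (fun t : ℝ => Complex.exp (Complex.I * k * t))
          (Complex.exp (Complex.I * k * t) * (Complex.I * k * 1)) t :=
        ((Complex.ofRealCLM.hasDerivAt (x := t)).const_mul (Complex.I * k)).cexp
      have e2 : HasDerivAt (fun t : ℝ => ((t - Real.pi : ℝ) : ℂ)) 1 t := by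
        have := ((hasDerivAt_id t).sub_const Real.pi).ofReal_comp
        simpa using this
      have e3 := (e2.mul (e1.div_const (Complex.I * k))).sub (e1.div_const ((Complex.I * k)^2))
      refine e3.congr_deriv ?_
      field_simp
      ring
    rw [intervalIntegral.integral_eq_sub_of_hasDerivAt hd]
    · rw [h1]
      simp only [Complex.ofReal_zero, mul_zero, Complex.exp_zero]
      push_cast
      field_simp
      ring_nf
      simp
    · apply Continuous.intervalIntegrable
      fun_prop

lemma mv_parseval (s : Finset ℕ) (x : ℕ → ℂ) :
    (∫ t in (0:ℝ)..(2*Real.pi), ‖∑ n ∈ s, x n * Complex.exp (Complex.I * (n:ℤ) * t)‖^2)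
    = 2 * Real.pi * ∑ n ∈ s, ‖x n‖^2 := by
  have key : (∫ t in (0:ℝ)..(2*Real.pi),
      (((‖∑ n ∈ s, x n * Complex.exp (Complex.I * (n:ℤ) * t)‖^2 : ℝ)) : ℂ))
      = ((2 * Real.pi * ∑ n ∈ s, ‖x n‖^2 : ℝ) : ℂ) := by
    have e : ∀ t : ℝ, (((‖∑ n ∈ s, x n * Complex.exp (Complex.I * (n:ℤ) * t)‖^2 : ℝ)) : ℂ)
        = ∑ n ∈ s, ∑ m ∈ s, (x n * (starRingEnd ℂ) (x m)) *
          Complex.exp (Complex.I * ((n:ℤ) - (m:ℤ) : ℤ) * t) := by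
      intro t
      rw [Complex.ofReal_pow, ← Complex.mul_conj', map_sum, Finset.sum_mul_sum]
      refine Finset.sum_congr rfl fun n _ => Finset.sum_congr rfl fun m _ => ?_
      rw [map_mul, ← Complex.exp_conj, mul_mul_mul_comm, ← Complex.exp_add]
      congr 2
      simp
      ring
    simp_rw [e]
    rw [intervalIntegral.integral_finsetSum]
    swap
    · intro i _
      apply Continuous.intervalIntegrable
      fun_prop
    push_cast
    rw [Finset.mul_sum]
    refine Finset.sum_congr rfl fun n hn => ?_
    rw [intervalIntegral.integral_finsetSum]
    swap
    · intro i _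
      apply Continuous.intervalIntegrable
      fun_prop
    simp_rw [intervalIntegral.integral_const_mul]
    have := fun m : ℕ => mv_int_exp ((n:ℤ) - m)
    push_cast at this
    simp_rw [this]
    rw [Finset.sum_eq_single n]
    · simp [Complex.mul_conj']; ring
    · intro m _ hm
      rw [if_neg]; · simp
      omega
    · simp [hn]
  rw [intervalIntegral.integral_ofReal] at key
  exact_mod_cast key

/-- The classical Hilbert inequality. -/
lemma mv_hilbert (s : Finset ℕ) (x y : ℕ → ℂ) :
    ‖∑ m ∈ s, ∑ n ∈ s, x m * y n * ((((n:ℝ) - (m:ℝ))⁻¹ : ℝ) : ℂ)‖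
      ≤ 2 * (∑ n ∈ s, ‖x n‖^2 + ∑ n ∈ s, ‖y n‖^2) := by
  set X : ℝ → ℂ := fun t => ∑ n ∈ s, (starRingEnd ℂ) (x n) * Complex.exp (Complex.I * (n:ℤ) * t) with hX
  set Y : ℝ → ℂ := fun t => ∑ n ∈ s, y n * Complex.exp (Complex.I * (n:ℤ) * t) with hY
  have cX : Continuous X := by simp only [hX]; fun_prop
  have cY : Continuous Y := by simp only [hY]; fun_prop
  have pi0 := Real.pi_pos
  have main : (∫ t in (0:ℝ)..(2*Real.pi), ((t - Real.pi : ℝ) : ℂ) * ((starRingEnd ℂ) (X t) * Y t))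
      = 2 * Real.pi * (-Complex.I) *
        ∑ m ∈ s, ∑ n ∈ s, x m * y n * ((((n:ℝ) - (m:ℝ))⁻¹ : ℝ) : ℂ) := by
    have e : ∀ t : ℝ, ((t - Real.pi : ℝ) : ℂ) * ((starRingEnd ℂ) (X t) * Y t) =
       ∑ m ∈ s, ∑ n ∈ s, (x m * y n) * (((t - Real.pi : ℝ) : ℂ) *
          Complex.exp (Complex.I * ((n:ℤ) - (m:ℤ) : ℤ) * t)) := by
      intro t
      rw [hX, hY, map_sum, Finset.sum_mul_sum, Finset.mul_sum]
      refine Finset.sum_congr rfl fun m _ => ?_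
      rw [Finset.mul_sum]
      refine Finset.sum_congr rfl fun n _ => ?_
      rw [map_mul, ← Complex.exp_conj, mul_mul_mul_comm, ← Complex.exp_add, mul_left_comm]
      congr 3
      · simp
      · simp
        ring
    simp_rw [e]
    rw [intervalIntegral.integral_finsetSum]
    swap
    · intro i _
      apply Continuous.intervalIntegrable
      fun_prop
    rw [Finset.mul_sum]
    refine Finset.sum_congr rfl fun m _ => ?_
    rw [intervalIntegral.integral_finsetSum]
    swap
    · intro i _
      apply Continuous.intervalIntegrable
      fun_prop
    rw [Finset.mul_sum]
    refine Finset.sum_congr rfl fun n _ => ?_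
    rw [intervalIntegral.integral_const_mul, mv_int_texp]
    push_cast
    ring
  have bound : ‖∫ t in (0:ℝ)..(2*Real.pi), ((t - Real.pi : ℝ) : ℂ) * ((starRingEnd ℂ) (X t) * Y t)‖
      ≤ ∫ t in (0:ℝ)..(2*Real.pi), Real.pi / 2 * (‖X t‖^2 + ‖Y t‖^2) := by
    apply intervalIntegral.norm_integral_le_of_norm_le (by positivity)
    · refine Filter.Eventually.of_forall fun t ht => ?_
      rw [norm_mul, norm_mul, Complex.norm_real, RCLike.norm_conj, Real.norm_eq_abs]
      have h1 : |t - Real.pi| ≤ Real.pi := by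
        rw [abs_le]; constructor <;> linarith [ht.1, ht.2]
      have h2 : ‖X t‖ * ‖Y t‖ ≤ (‖X t‖^2 + ‖Y t‖^2)/2 := by nlinarith [sq_nonneg (‖X t‖ - ‖Y t‖)]
      calc _ ≤ Real.pi * ((‖X t‖^2 + ‖Y t‖^2)/2) := by gcongr
        _ = _ := by ring
    · apply Continuous.intervalIntegrable
      fun_prop
  rw [intervalIntegral.integral_const_mul, intervalIntegral.integral_add
    (by apply Continuous.intervalIntegrable; fun_prop)
    (by apply Continuous.intervalIntegrable; fun_prop), hX, hY, mv_parseval, mv_parseval, main] at bound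
  simp only [norm_mul, RCLike.norm_conj, norm_neg, Complex.norm_I, Complex.norm_real, mul_one,
    Complex.norm_ofNat, Real.norm_eq_abs, abs_of_pos pi0] at bound
  set A := ∑ n ∈ s, ‖x n‖^2
  set B := ∑ n ∈ s, ‖y n‖^2
  have hA : 0 ≤ A := Finset.sum_nonneg fun _ _ => by positivity
  have hB : 0 ≤ B := Finset.sum_nonneg fun _ _ => by positivity
  have h3 : 2 * Real.pi * ‖∑ m ∈ s, ∑ n ∈ s, x m * y n * ((((n:ℝ) - (m:ℝ))⁻¹ : ℝ) : ℂ)‖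
     ≤ 2 * Real.pi * (Real.pi / 2 * (A + B)) := by linarith
  have h4 := le_of_mul_le_mul_left h3 (by positivity)
  nlinarith [Real.pi_le_four]
/-- kernel estimate for m < n -/
lemma mv_kernel_lt (m n : ℕ) (hm : 1 ≤ m) (hmn : m < n) :
    |(Real.log n - Real.log m)⁻¹ - Real.sqrt m * Real.sqrt n * ((n:ℝ) - m)⁻¹
      - (Real.log 2)⁻¹ * ((Nat.log 2 n : ℝ) - (Nat.log 2 m : ℝ))⁻¹|
    ≤ 520 / (1 + ((Nat.log 2 n : ℝ) - (Nat.log 2 m : ℝ))^2) := by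
  have m0 : (0:ℝ) < m := by exact_mod_cast hm
  have mn : (m:ℝ) < n := by exact_mod_cast hmn
  have n0 : (0:ℝ) < n := m0.trans mn
  have l2 := Real.log_two_gt_d9
  have l2' := Real.log_two_lt_d9
  set q : ℝ := Real.sqrt n / Real.sqrt m with hq
  have sm : 0 < Real.sqrt m := Real.sqrt_pos.2 m0
  have sn : 0 < Real.sqrt n := Real.sqrt_pos.2 n0
  have q1 : 1 < q := by
    rw [hq, one_lt_div sm]; exact Real.sqrt_lt_sqrt m0.le mn
  have q0 : 0 < q := by linarith
  have hL : Real.log n - Real.log m = 2 * Real.log q := by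
    rw [hq, Real.log_div sn.ne' sm.ne', Real.log_sqrt n0.le, Real.log_sqrt m0.le]; ring
  have hS : Real.sqrt m * Real.sqrt n * ((n:ℝ) - m)⁻¹ = q / (q^2 - 1) := by
    have e1 : (n:ℝ) = (Real.sqrt n)^2 := (Real.sq_sqrt n0.le).symm
    have e2 : (m:ℝ) = (Real.sqrt m)^2 := (Real.sq_sqrt m0.le).symm
    have e3 : ((n:ℝ) - m) ≠ 0 := by linarith
    have e4 : (q^2 - 1) ≠ 0 := by nlinarith
    have e5 : q * Real.sqrt m = Real.sqrt n := by rw [hq]; field_simp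
    rw [mul_inv_eq_iff_eq_mul₀ e3, div_mul_eq_mul_div, eq_div_iff e4]
    have : (n:ℝ) - m = (Real.sqrt m)^2 * (q^2-1) := by
      rw [e1, ← e5]; linear_combination -e2
    rw [this, ← e5]; ring
  have lq0 : 0 < Real.log q := Real.log_pos q1
  have lq1 : Real.log q ≤ q - 1 := Real.log_le_sub_one_of_pos q0
  have lq2 : (q - 1)/q ≤ Real.log q := by
    have := Real.one_sub_inv_le_log_of_pos q0
    rw [sub_div, div_self q0.ne', one_div]; exact this
  have hb : |(Real.log n - Real.log m)⁻¹ - Real.sqrt m * Real.sqrt n * ((n:ℝ) - m)⁻¹| ≤ 1/2 := by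
    rw [hL, hS, abs_le]
    have i1 : (2 * Real.log q)⁻¹ ≤ q / (2*(q-1)) := by
      rw [inv_le_comm₀ (by positivity) (by apply div_pos q0; linarith), inv_div]
      calc 2*(q-1)/q = 2*((q-1)/q) := by ring
        _ ≤ _ := by linarith
    have i2 : 1/(2*(q-1)) ≤ (2 * Real.log q)⁻¹ := by
      rw [one_div]; apply inv_anti₀ (by positivity); linarith
    have q1' : q - 1 ≠ 0 := by linarith
    have q1'' : q + 1 ≠ 0 := by linarith
    have hf : q^2 - 1 = (q-1)*(q+1) := by ring
    have j1 : q/(2*(q-1)) - q/(q^2-1) = q/(2*(q+1)) := by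
      rw [hf]; field_simp; ring
    have j2 : 1/(2*(q-1)) - q/(q^2-1) = -(1/(2*(q+1))) := by
      rw [hf]; field_simp; ring
    have k1 : q/(2*(q+1)) ≤ 1/2 := by rw [div_le_iff₀ (by positivity)]; linarith
    have k2 : 1/(2*(q+1)) ≤ 1/2 := by rw [div_le_iff₀ (by positivity)]; linarith
    constructor <;> linarith
  have hmono : Nat.log 2 m ≤ Nat.log 2 n := Nat.log_mono_right hmn.le
  obtain ⟨d, hd⟩ := Nat.exists_eq_add_of_le hmono
  have hd' : (Nat.log 2 n : ℝ) - (Nat.log 2 m : ℝ) = d := by rw [hd]; push_cast; ring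
  have lo : ∀ k : ℕ, 1 ≤ k → (Nat.log 2 k : ℝ) * Real.log 2 ≤ Real.log k ∧
      Real.log k ≤ ((Nat.log 2 k : ℝ) + 1) * Real.log 2 := by
    intro k hk
    have a1 : ((2:ℝ)^(Nat.log 2 k)) ≤ k := by exact_mod_cast Nat.pow_log_le_self 2 (by omega)
    have a2 : (k:ℝ) ≤ (2:ℝ)^(Nat.log 2 k + 1) := by
      exact_mod_cast (Nat.lt_pow_succ_log_self (by norm_num) k).le
    have b1 := Real.log_le_log (by positivity) a1
    have b2 := Real.log_le_log (by exact_mod_cast hk) a2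
    rw [Real.log_pow] at b1 b2
    push_cast at b2
    exact ⟨b1, b2⟩
  obtain ⟨m1, m2⟩ := lo m hm
  obtain ⟨n1, n2⟩ := lo n (by omega)
  rw [hd']
  have L1 : ((d:ℝ) - 1) * Real.log 2 ≤ Real.log n - Real.log m := by rw [← hd']; linarith
  have L2 : Real.log n - Real.log m ≤ ((d:ℝ) + 1) * Real.log 2 := by rw [← hd']; linarith
  rcases Nat.lt_or_ge d 2 with hlt | hge
  · have h2 : |(Real.log 2)⁻¹ * (d:ℝ)⁻¹| ≤ 2 := by
      interval_cases d
      · simp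
      · simp only [Nat.cast_one, inv_one, mul_one]
        rw [abs_of_pos (by positivity), inv_le_comm₀ (by positivity) (by norm_num)]
        linarith
    have h3 : (5/2:ℝ) ≤ 520/(1+(d:ℝ)^2) := by
      interval_cases d <;> norm_num
    exact (abs_sub _ _).trans (by linarith)
  · have dge : (2:ℝ) ≤ d := by exact_mod_cast hge
    set L := Real.log n - Real.log m with hLd
    have Ld : (d:ℝ)/2 * Real.log 2 ≤ L := by nlinarith
    have Ld4 : (d:ℝ)/4 ≤ L := by nlinarith
    have L0 : 0 < L := by linarith
    have t1 : |L⁻¹ - (Real.log 2)⁻¹ * (d:ℝ)⁻¹| ≤ 4 / (d:ℝ)^2 := by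
      have : L⁻¹ - (Real.log 2)⁻¹ * (d:ℝ)⁻¹ = (d * Real.log 2 - L) / (L * (d * Real.log 2)) := by
        field_simp
      rw [this, abs_div, abs_of_pos (by positivity : 0 < L * (d * Real.log 2)),
        div_le_div_iff₀ (by positivity) (by positivity)]
      have u : |d * Real.log 2 - L| ≤ Real.log 2 := by
        rw [abs_le]; constructor <;> linarith
      calc |d * Real.log 2 - L| * (d:ℝ)^2 ≤ Real.log 2 * (d:ℝ)^2 := by gcongr
        _ = 4 * ((d/4) * (d * Real.log 2)) := by ring
        _ ≤ 4 * (L * (d * Real.log 2)) := by gcongr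
    have t2 : |Real.sqrt m * Real.sqrt n * ((n:ℝ) - m)⁻¹| ≤ 256 / (d:ℝ)^2 := by
      rw [hS]
      have qe : q = Real.exp (L/2) := by
        rw [hL, mul_div_cancel_left₀ _ (by norm_num), Real.exp_log q0]
      have qq := Real.quadratic_le_exp_of_nonneg (x := L/2) (by positivity)
      rw [← qe] at qq
      have qd : (d:ℝ)^2/128 ≤ q := by
        have : ((d:ℝ)/4)^2 ≤ L^2 := pow_le_pow_left₀ (by positivity) Ld4 2
        linarith
      have q2 : 2 ≤ q^2 := by
        have : q^2 = Real.exp L := by rw [qe, ← Real.exp_nat_mul]; congr 1; push_cast; ring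
        rw [this, ← Real.log_le_iff_le_exp (by norm_num)]
        have : 1 * Real.log 2 ≤ (d:ℝ)/2 * Real.log 2 := by gcongr; linarith
        linarith
      have q3 : 0 < q^2 - 1 := by linarith
      rw [abs_of_pos (by positivity), div_le_div_iff₀ q3 (by positivity)]
      have : q * ((d:ℝ)^2/128) ≤ q * q := by gcongr
      linarith [sq q]
    have t3 : 260 / (d:ℝ)^2 ≤ 520/(1+(d:ℝ)^2) := by
      rw [div_le_div_iff₀ (by positivity) (by positivity)]
      nlinarith
    have : L⁻¹ - Real.sqrt m * Real.sqrt n * ((n:ℝ) - m)⁻¹ - (Real.log 2)⁻¹ * (d:ℝ)⁻¹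
      = (L⁻¹ - (Real.log 2)⁻¹ * (d:ℝ)⁻¹) - Real.sqrt m * Real.sqrt n * ((n:ℝ) - m)⁻¹ := by ring
    rw [this]
    refine (abs_sub _ _).trans ?_
    have : 4 / (d:ℝ)^2 + 256 / (d:ℝ)^2 = 260/(d:ℝ)^2 := by ring
    linarith

lemma mv_kernel (m n : ℕ) (hm : 1 ≤ m) (hn : 1 ≤ n) :
    |(Real.log n - Real.log m)⁻¹ - Real.sqrt m * Real.sqrt n * ((n:ℝ) - m)⁻¹
      - (Real.log 2)⁻¹ * ((Nat.log 2 n : ℝ) - (Nat.log 2 m : ℝ))⁻¹|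
    ≤ 520 / (1 + ((Nat.log 2 n : ℝ) - (Nat.log 2 m : ℝ))^2) := by
  rcases lt_trichotomy m n with h | h | h
  · exact mv_kernel_lt m n hm h
  · subst h; simp
  · have := mv_kernel_lt n m hn h
    rw [← abs_neg, ← neg_sub (Nat.log 2 m : ℝ), neg_sq]
    convert this using 2
    rw [← neg_sub (Real.log m), ← neg_sub (m:ℝ), inv_neg, inv_neg, inv_neg]
    ring

lemma mv_weight : ∃ W : ℝ, 0 < W ∧ ∀ (s : Finset ℕ) (j : ℕ),
    ∑ k ∈ s, 1 / (1 + ((k:ℝ) - j)^2) ≤ W := by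
  have hsum : Summable (fun k : ℤ => 1 / (1 + (k:ℝ)^2)) := by
    have h1 : Summable (fun k : ℕ => 1 / (1 + (k:ℝ)^2)) := by
      refine Summable.of_nonneg_of_le (fun k => by positivity) (fun k => ?_)
        (((summable_nat_add_iff 1).2 (Real.summable_one_div_nat_pow.2 (by norm_num : 1 < 2))).mul_left 2)
      push_cast
      rw [mul_one_div, div_le_div_iff₀ (by positivity) (by positivity)]
      nlinarith [sq_nonneg ((k:ℝ)-1)]
    apply Summable.of_nat_of_neg <;> simpa using h1
  refine ⟨(∑' k : ℤ, 1 / (1 + (k:ℝ)^2)) + 1, ?_, fun s j => ?_⟩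
  · have : 0 ≤ ∑' k : ℤ, 1 / (1 + (k:ℝ)^2) := tsum_nonneg fun k => by positivity
    linarith
  · have hi : Function.Injective (fun k : ℕ => (k:ℤ) - j) := fun a b h => by
      simp only at h; omega
    have := hsum.sum_le_tsum (s.map ⟨_, hi⟩) (fun k _ => by positivity)
    rw [Finset.sum_map] at this
    simp only [Function.Embedding.coeFn_mk] at this
    push_cast at this
    linarith

lemma mv_block (s t : Finset ℕ) (hmaps : ∀ n ∈ s, Nat.log 2 n ∈ t) (hpos : ∀ n ∈ s, 1 ≤ n)
    (a : ℕ → ℂ) :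
    ∑ j ∈ t, (∑ n ∈ s with Nat.log 2 n = j, ‖a n‖)^2 ≤ ∑ n ∈ s, (n:ℝ) * ‖a n‖^2 := by
  rw [← Finset.sum_fiberwise_of_maps_to hmaps]
  refine Finset.sum_le_sum fun j _ => ?_
  refine (sq_sum_le_card_mul_sum_sq).trans ?_
  rw [Finset.mul_sum]
  refine Finset.sum_le_sum fun n hn => ?_
  gcongr
  rw [Finset.mem_filter] at hn
  have h1 : 2^j ≤ n := by
    rw [← hn.2]; exact Nat.pow_log_le_self 2 (by have := hpos n hn.1; omega)
  have h2 : ({n ∈ s | Nat.log 2 n = j} : Finset ℕ) ⊆ Finset.Ico (2^j) (2^(j+1)) := by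
    intro k hk
    rw [Finset.mem_filter] at hk
    rw [Finset.mem_Ico, ← hk.2]
    exact ⟨Nat.pow_log_le_self 2 (by have := hpos k hk.1; omega),
      Nat.lt_pow_succ_log_self (by norm_num) k⟩
  have h3 := Finset.card_le_card h2
  rw [Nat.card_Ico, pow_succ] at h3
  omega

lemma mv_R : ∃ C : ℝ, 0 < C ∧ ∀ (N : ℕ) (a b : ℕ → ℂ),
    ∑ m ∈ Finset.Icc 1 N, ∑ n ∈ Finset.Icc 1 N, ‖a m‖ * ‖b n‖ *
      (1 / (1 + ((Nat.log 2 n : ℝ) - (Nat.log 2 m : ℝ))^2))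
    ≤ C * (∑ n ∈ Finset.Icc 1 N, (n:ℝ) * ‖a n‖^2 + ∑ n ∈ Finset.Icc 1 N, (n:ℝ) * ‖b n‖^2) := by
  obtain ⟨W, W0, hW⟩ := mv_weight
  refine ⟨W, W0, fun N a b => ?_⟩
  set s := Finset.Icc 1 N
  set t := Finset.range (N+1)
  have hmaps : ∀ n ∈ s, Nat.log 2 n ∈ t := by
    intro n hn
    have := Nat.log_le_self 2 n
    simp only [s, t, Finset.mem_Icc, Finset.mem_range] at *
    omega
  let F : (ℕ → ℂ) → ℕ → ℝ := fun a j => ∑ n ∈ s with Nat.log 2 n = j, ‖a n‖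
  have hF0 : ∀ a j, 0 ≤ F a j := fun a j => Finset.sum_nonneg fun _ _ => norm_nonneg _
  have hF : ∀ a : ℕ → ℂ, ∑ j ∈ t, (F a j)^2 ≤ ∑ n ∈ s, (n:ℝ) * ‖a n‖^2 := by
    intro a
    exact mv_block s t hmaps (by intro n hn; simp only [s, Finset.mem_Icc] at hn; omega) a
  have e : ∑ m ∈ s, ∑ n ∈ s, ‖a m‖ * ‖b n‖ *
      (1 / (1 + ((Nat.log 2 n : ℝ) - (Nat.log 2 m : ℝ))^2))
      = ∑ j ∈ t, ∑ k ∈ t, F a j * F b k * (1 / (1 + ((k:ℝ) - (j:ℝ))^2)) := by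
    rw [← Finset.sum_fiberwise_of_maps_to hmaps]
    refine Finset.sum_congr rfl fun j _ => ?_
    have : ∀ m ∈ ({m ∈ s | Nat.log 2 m = j} : Finset ℕ), ∑ n ∈ s, ‖a m‖ * ‖b n‖ *
      (1 / (1 + ((Nat.log 2 n : ℝ) - (Nat.log 2 m : ℝ))^2))
       = ∑ k ∈ t, ‖a m‖ * F b k * (1 / (1 + ((k:ℝ) - (j:ℝ))^2)) := by
      intro m hm
      rw [← Finset.sum_fiberwise_of_maps_to hmaps]
      refine Finset.sum_congr rfl fun k _ => ?_
      simp only [F]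
      rw [Finset.mul_sum, Finset.sum_mul]
      refine Finset.sum_congr rfl fun n hn => ?_
      rw [(Finset.mem_filter.1 hm).2, (Finset.mem_filter.1 hn).2]
    rw [Finset.sum_congr rfl this, Finset.sum_comm]
    refine Finset.sum_congr rfl fun k _ => ?_
    rw [← Finset.sum_mul, ← Finset.sum_mul]
  rw [e]
  have e2 : ∑ j ∈ t, ∑ k ∈ t, F a j * F b k * (1 / (1 + ((k:ℝ) - (j:ℝ))^2))
      ≤ ∑ j ∈ t, ∑ k ∈ t, ((F a j)^2 * (1 / (1 + ((k:ℝ) - (j:ℝ))^2))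
         + (F b k)^2 * (1 / (1 + ((j:ℝ) - (k:ℝ))^2))) := by
    refine Finset.sum_le_sum fun j _ => Finset.sum_le_sum fun k _ => ?_
    rw [← neg_sub (j:ℝ), neg_sq, ← add_mul]
    gcongr
    nlinarith [sq_nonneg (F a j - F b k), sq_nonneg (F a j), sq_nonneg (F b k)]
  refine e2.trans ?_
  simp_rw [Finset.sum_add_distrib]
  rw [mul_add]
  apply add_le_add
  · calc _ = ∑ j ∈ t, (F a j)^2 * ∑ k ∈ t, (1 / (1 + ((k:ℝ) - (j:ℝ))^2)) := by
          simp_rw [Finset.mul_sum]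
      _ ≤ ∑ j ∈ t, (F a j)^2 * W := by
          refine Finset.sum_le_sum fun j _ => ?_
          gcongr
          exact hW t j
      _ = W * ∑ j ∈ t, (F a j)^2 := by rw [← Finset.sum_mul, mul_comm]
      _ ≤ _ := by gcongr; exact hF a
  · rw [Finset.sum_comm]
    calc _ = ∑ j ∈ t, (F b j)^2 * ∑ k ∈ t, (1 / (1 + ((k:ℝ) - (j:ℝ))^2)) := by
          simp_rw [Finset.mul_sum]
      _ ≤ ∑ j ∈ t, (F b j)^2 * W := by
          refine Finset.sum_le_sum fun j _ => ?_
          gcongr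
          exact hW t j
      _ = W * ∑ j ∈ t, (F b j)^2 := by rw [← Finset.sum_mul, mul_comm]
      _ ≤ _ := by gcongr; exact hF b

lemma mv_bilin : ∃ C : ℝ, 0 < C ∧ ∀ (N : ℕ) (a b : ℕ → ℂ),
    ‖∑ m ∈ Finset.Icc 1 N, ∑ n ∈ Finset.Icc 1 N, a m * b n *
      (((Real.log n - Real.log m)⁻¹ : ℝ) : ℂ)‖
    ≤ C * (∑ n ∈ Finset.Icc 1 N, (n:ℝ) * ‖a n‖^2 + ∑ n ∈ Finset.Icc 1 N, (n:ℝ) * ‖b n‖^2) := by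
  obtain ⟨C, C0, hC⟩ := mv_R
  refine ⟨2 + 4 + 520 * C, by positivity, fun N a b => ?_⟩
  have hR := hC N a b
  set s := Finset.Icc 1 N with hs
  set t := Finset.range (N+1)
  have hpos : ∀ n ∈ s, 1 ≤ n := fun n hn => by simp only [s, Finset.mem_Icc] at hn; omega
  have hmaps : ∀ n ∈ s, Nat.log 2 n ∈ t := by
    intro n hn
    have := Nat.log_le_self 2 n
    simp only [s, t, Finset.mem_Icc, Finset.mem_range] at *
    omega
  let G : (ℕ → ℂ) → ℕ → ℂ := fun a j => ∑ n ∈ s with Nat.log 2 n = j, a n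
  have hG : ∀ a : ℕ → ℂ, ∑ j ∈ t, ‖G a j‖^2 ≤ ∑ n ∈ s, (n:ℝ) * ‖a n‖^2 := by
    intro a
    refine le_trans ?_ (mv_block s t hmaps hpos a)
    refine Finset.sum_le_sum fun j _ => ?_
    gcongr
    exact norm_sum_le _ _
  set P := ∑ n ∈ s, (n:ℝ) * ‖a n‖^2
  set Q := ∑ n ∈ s, (n:ℝ) * ‖b n‖^2
  have hP : 0 ≤ P := Finset.sum_nonneg fun _ _ => by positivity
  have hQ : 0 ≤ Q := Finset.sum_nonneg fun _ _ => by positivity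
  let R : ℕ → ℕ → ℝ := fun m n => (Real.log n - Real.log m)⁻¹
      - Real.sqrt m * Real.sqrt n * ((n:ℝ) - m)⁻¹
      - (Real.log 2)⁻¹ * ((Nat.log 2 n : ℝ) - (Nat.log 2 m : ℝ))⁻¹
  have h1 := mv_hilbert s (fun m => (Real.sqrt m : ℂ) * a m) (fun n => (Real.sqrt n : ℂ) * b n)
  have h2 := mv_hilbert t (G a) (G b)
  have e1 : ∀ a : ℕ → ℂ, ∑ n ∈ s, ‖(Real.sqrt n : ℂ) * a n‖^2 = ∑ n ∈ s, (n:ℝ) * ‖a n‖^2 := by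
    intro a
    refine Finset.sum_congr rfl fun n _ => ?_
    rw [norm_mul, Complex.norm_real, mul_pow, Real.norm_eq_abs, sq_abs, Real.sq_sqrt (Nat.cast_nonneg n)]
  rw [e1, e1] at h1
  have h2' := h2.trans (mul_le_mul_of_nonneg_left (add_le_add (hG a) (hG b)) (by norm_num))
  have e2 : ∑ j ∈ t, ∑ k ∈ t, G a j * G b k * ((((k:ℝ) - (j:ℝ))⁻¹ : ℝ) : ℂ)
     = ∑ m ∈ s, ∑ n ∈ s, a m * b n * ((((Nat.log 2 n : ℝ) - (Nat.log 2 m : ℝ))⁻¹ : ℝ) : ℂ) := by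
    symm
    rw [← Finset.sum_fiberwise_of_maps_to hmaps]
    refine Finset.sum_congr rfl fun j _ => ?_
    have : ∀ m ∈ ({m ∈ s | Nat.log 2 m = j} : Finset ℕ), ∑ n ∈ s, a m * b n *
      ((((Nat.log 2 n : ℝ) - (Nat.log 2 m : ℝ))⁻¹ : ℝ) : ℂ)
       = ∑ k ∈ t, a m * G b k * ((((k:ℝ) - (j:ℝ))⁻¹ : ℝ) : ℂ) := by
      intro m hm
      rw [← Finset.sum_fiberwise_of_maps_to hmaps]
      refine Finset.sum_congr rfl fun k _ => ?_
      simp only [G]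
      rw [Finset.mul_sum, Finset.sum_mul]
      refine Finset.sum_congr rfl fun n hn => ?_
      rw [(Finset.mem_filter.1 hm).2, (Finset.mem_filter.1 hn).2]
    rw [Finset.sum_congr rfl this, Finset.sum_comm]
    refine Finset.sum_congr rfl fun k _ => ?_
    rw [← Finset.sum_mul, ← Finset.sum_mul]
  rw [e2] at h2'
  have h3 : ‖∑ m ∈ s, ∑ n ∈ s, a m * b n * (R m n : ℂ)‖ ≤ 520 * (C * (P + Q)) := by
    refine le_trans ?_ (mul_le_mul_of_nonneg_left hR (by norm_num))
    rw [Finset.mul_sum]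
    refine (norm_sum_le _ _).trans (Finset.sum_le_sum fun m hm => ?_)
    rw [Finset.mul_sum]
    refine (norm_sum_le _ _).trans (Finset.sum_le_sum fun n hn => ?_)
    rw [norm_mul, norm_mul, Complex.norm_real, Real.norm_eq_abs]
    calc _ ≤ ‖a m‖ * ‖b n‖ * (520 / (1 + ((Nat.log 2 n : ℝ) - (Nat.log 2 m : ℝ))^2)) := by
          gcongr
          exact mv_kernel m n (hpos m hm) (hpos n hn)
      _ = _ := by ring
  have e3 : ∑ m ∈ s, ∑ n ∈ s, a m * b n * (((Real.log n - Real.log m)⁻¹ : ℝ) : ℂ)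
     = (∑ m ∈ s, ∑ n ∈ s, ((Real.sqrt m : ℂ) * a m) * ((Real.sqrt n : ℂ) * b n) *
          ((((n:ℝ) - (m:ℝ))⁻¹ : ℝ) : ℂ))
       + (((Real.log 2)⁻¹ : ℝ) : ℂ) * (∑ m ∈ s, ∑ n ∈ s, a m * b n *
          ((((Nat.log 2 n : ℝ) - (Nat.log 2 m : ℝ))⁻¹ : ℝ) : ℂ))
       + ∑ m ∈ s, ∑ n ∈ s, a m * b n * (R m n : ℂ) := by
    simp_rw [Finset.mul_sum, ← Finset.sum_add_distrib]
    refine Finset.sum_congr rfl fun m _ => Finset.sum_congr rfl fun n _ => ?_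
    simp only [R]
    push_cast
    ring
  rw [e3]
  refine (norm_add_le _ _).trans ?_
  have h4 := norm_add_le (∑ m ∈ s, ∑ n ∈ s, ((Real.sqrt m : ℂ) * a m) * ((Real.sqrt n : ℂ) * b n) *
          ((((n:ℝ) - (m:ℝ))⁻¹ : ℝ) : ℂ)) ((((Real.log 2)⁻¹ : ℝ) : ℂ) * (∑ m ∈ s, ∑ n ∈ s, a m * b n *
          ((((Nat.log 2 n : ℝ) - (Nat.log 2 m : ℝ))⁻¹ : ℝ) : ℂ)))
  have h5 : ‖(((Real.log 2)⁻¹ : ℝ) : ℂ) * (∑ m ∈ s, ∑ n ∈ s, a m * b n *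
          ((((Nat.log 2 n : ℝ) - (Nat.log 2 m : ℝ))⁻¹ : ℝ) : ℂ))‖ ≤ 2 * (2 * (P + Q)) := by
    rw [norm_mul, Complex.norm_real, Real.norm_eq_abs]
    have l2 := Real.log_two_gt_d9
    have : |(Real.log 2)⁻¹| ≤ 2 := by
      rw [abs_of_pos (by positivity), inv_le_comm₀ (by positivity) (by norm_num)]
      linarith
    gcongr
  linarith

lemma mv_cpow (n : ℕ) (hn : 1 ≤ n) (z : ℂ) : (n:ℂ)^z = Complex.exp (Real.log n * z) := by
  rw [Complex.cpow_def_of_ne_zero (by exact_mod_cast (by omega : n ≠ 0)), Complex.natCast_log]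

lemma mv_int (θ T : ℝ) : (∫ t in (0:ℝ)..T, Complex.exp (Complex.I * θ * t))
    = (if θ = 0 then (T:ℂ) else 0)
      + (Complex.exp (Complex.I * θ * T) - 1) * ((θ⁻¹ : ℝ) : ℂ) * (-Complex.I) := by
  split_ifs with h
  · subst h; simp
  · have h0 : (θ:ℂ) ≠ 0 := by exact_mod_cast h
    have hk : (Complex.I * θ) ≠ 0 := mul_ne_zero Complex.I_ne_zero h0
    rw [integral_exp_mul_complex hk]
    simp only [Complex.ofReal_zero, mul_zero, Complex.exp_zero]
    push_cast
    rw [zero_add, div_eq_mul_inv, mul_inv, Complex.inv_I]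
    ring

lemma mv_identity (N : ℕ) (T : ℝ) (a b : ℕ → ℂ) :
    (∫ t in (0:ℝ)..T,
        (∑ n ∈ Finset.Icc 1 N, a n * (n : ℂ) ^ (-(Complex.I * t))) *
        (∑ n ∈ Finset.Icc 1 N, b n * (n : ℂ) ^ (Complex.I * t)))
      - T * ∑ n ∈ Finset.Icc 1 N, a n * b n
    = (-Complex.I) * ((∑ m ∈ Finset.Icc 1 N, ∑ n ∈ Finset.Icc 1 N,
        (a m * Complex.exp ((-(Real.log m * T) : ℝ) * Complex.I)) *
        (b n * Complex.exp ((Real.log n * T : ℝ) * Complex.I)) *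
          (((Real.log n - Real.log m)⁻¹ : ℝ) : ℂ))
      - ∑ m ∈ Finset.Icc 1 N, ∑ n ∈ Finset.Icc 1 N, a m * b n *
          (((Real.log n - Real.log m)⁻¹ : ℝ) : ℂ)) := by
  set s := Finset.Icc 1 N with hs
  have hpos : ∀ n ∈ s, 1 ≤ n := fun n hn => by simp only [s, Finset.mem_Icc] at hn; omega
  have e : ∀ t : ℝ, (∑ n ∈ s, a n * (n : ℂ) ^ (-(Complex.I * t))) *
        (∑ n ∈ s, b n * (n : ℂ) ^ (Complex.I * t))
      = ∑ m ∈ s, ∑ n ∈ s, (a m * b n) *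
         Complex.exp (Complex.I * ((Real.log n - Real.log m : ℝ) : ℂ) * t) := by
    intro t
    rw [Finset.sum_mul_sum]
    refine Finset.sum_congr rfl fun m hm => Finset.sum_congr rfl fun n hn => ?_
    rw [mv_cpow m (hpos m hm), mv_cpow n (hpos n hn), mul_mul_mul_comm, ← Complex.exp_add]
    congr 2
    push_cast
    ring
  simp_rw [e]
  rw [intervalIntegral.integral_finsetSum]
  swap
  · intro i _
    apply Continuous.intervalIntegrable
    fun_prop
  rw [← Finset.sum_sub_distrib, Finset.mul_sum, Finset.mul_sum, ← Finset.sum_sub_distrib]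
  refine Finset.sum_congr rfl fun m hm => ?_
  rw [intervalIntegral.integral_finsetSum]
  swap
  · intro i _
    apply Continuous.intervalIntegrable
    fun_prop
  simp_rw [intervalIntegral.integral_const_mul, mv_int, mul_add]
  rw [Finset.sum_add_distrib]
  have d : ∑ n ∈ s, a m * b n * (if Real.log n - Real.log m = 0 then (T:ℂ) else 0)
      = T * (a m * b m) := by
    rw [Finset.sum_eq_single m]
    · simp; ring
    · intro n hn hnm
      rw [if_neg]; · simp
      intro h
      have m0 : (0:ℝ) < m := by exact_mod_cast hpos m hm
      have n0 : (0:ℝ) < n := by exact_mod_cast hpos n hn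
      have := Real.log_injOn_pos n0 m0 (sub_eq_zero.1 h)
      exact hnm (by exact_mod_cast this)
    · simp [hm]
  rw [d, add_sub_cancel_left, ← Finset.sum_sub_distrib, Finset.mul_sum]
  refine Finset.sum_congr rfl fun n hn => ?_
  have : Complex.exp (Complex.I * ((Real.log n - Real.log m : ℝ) : ℂ) * T)
      = Complex.exp ((-(Real.log m * T) : ℝ) * Complex.I) *
        Complex.exp ((Real.log n * T : ℝ) * Complex.I) := by
    rw [← Complex.exp_add]; congr 1; push_cast; ring
  rw [this]
  ring

/-- Montgomery–Vaughan mean value theorem for Dirichlet polynomials, with an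
absolute implied constant. -/
theorem stmt_1 : ∃ C : ℝ, 0 < C ∧ ∀ (N : ℕ) (T : ℝ) (a b : ℕ → ℂ), 0 ≤ T →
    ‖(∫ t in (0:ℝ)..T,
        (∑ n ∈ Finset.Icc 1 N, a n * (n : ℂ) ^ (-(Complex.I * t))) *
        (∑ n ∈ Finset.Icc 1 N, b n * (n : ℂ) ^ (Complex.I * t)))
      - T * ∑ n ∈ Finset.Icc 1 N, a n * b n‖
    ≤ C * (∑ n ∈ Finset.Icc 1 N, (n : ℝ) * ‖a n‖ ^ 2) ^ ((1:ℝ)/2) *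
          (∑ n ∈ Finset.Icc 1 N, (n : ℝ) * ‖b n‖ ^ 2) ^ ((1:ℝ)/2) := by
  obtain ⟨C, C0, hC⟩ := mv_bilin
  refine ⟨4 * C, by positivity, fun N T a b _ => ?_⟩
  rw [mv_identity]
  rw [← Real.sqrt_eq_rpow, ← Real.sqrt_eq_rpow]
  set s := Finset.Icc 1 N with hs
  set P := ∑ n ∈ s, (n:ℝ) * ‖a n‖^2 with hPd
  set Q := ∑ n ∈ s, (n:ℝ) * ‖b n‖^2 with hQd
  have hP : 0 ≤ P := Finset.sum_nonneg fun _ _ => by positivity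
  have hQ : 0 ≤ Q := Finset.sum_nonneg fun _ _ => by positivity
  -- from the additive bound to the multiplicative one
  have key : ∀ aa bb : ℕ → ℂ, (∀ n, ‖aa n‖ = ‖a n‖) → (∀ n, ‖bb n‖ = ‖b n‖) →
      ‖∑ m ∈ s, ∑ n ∈ s, aa m * bb n * (((Real.log n - Real.log m)⁻¹ : ℝ) : ℂ)‖
        ≤ 2 * C * (Real.sqrt P * Real.sqrt Q) := by
    intro aa bb ha hb
    set E := ‖∑ m ∈ s, ∑ n ∈ s, aa m * bb n * (((Real.log n - Real.log m)⁻¹ : ℝ) : ℂ)‖ with hE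
    have E0 : 0 ≤ E := norm_nonneg _
    have h1 : ∀ c : ℝ, 0 < c → E * c ≤ C * (P * (c * c) + Q) := by
      intro c hc
      have h := hC N (fun n => (c:ℂ) * aa n) bb
      have f1 : ∑ m ∈ s, ∑ n ∈ s, ((c:ℂ) * aa m) * bb n * (((Real.log n - Real.log m)⁻¹ : ℝ) : ℂ)
         = (c:ℂ) * ∑ m ∈ s, ∑ n ∈ s, aa m * bb n * (((Real.log n - Real.log m)⁻¹ : ℝ) : ℂ) := by
        simp_rw [Finset.mul_sum]
        refine Finset.sum_congr rfl fun m _ => Finset.sum_congr rfl fun n _ => ?_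
        ring
      have f2 : ∑ n ∈ s, (n:ℝ) * ‖(c:ℂ) * aa n‖^2 = P * (c * c) := by
        rw [hPd, Finset.sum_mul]
        refine Finset.sum_congr rfl fun n _ => ?_
        rw [norm_mul, Complex.norm_real, Real.norm_eq_abs, abs_of_pos hc, ha]
        ring
      have f3 : ∑ n ∈ s, (n:ℝ) * ‖bb n‖^2 = Q := by simp_rw [hb]; rfl
      simp only [← hs] at h
      rw [f1, f2, f3, norm_mul, Complex.norm_real, Real.norm_eq_abs, abs_of_pos hc] at h
      linarith
    have h2 : ∀ c : ℝ, 0 ≤ (C * P) * (c * c) + (-E) * c + C * Q := by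
      intro c
      rcases le_or_gt c 0 with hc | hc
      · have : 0 ≤ (C * P) * (c * c) := by have := mul_self_nonneg c; positivity
        have : 0 ≤ C * Q := by positivity
        nlinarith
      · have := h1 c hc
        linarith
    have h3 := discrim_le_zero h2
    rw [discrim] at h3
    refine (pow_le_pow_iff_left₀ E0 (by positivity) two_ne_zero).1 ?_
    rw [mul_pow, mul_pow (Real.sqrt P), Real.sq_sqrt hP, Real.sq_sqrt hQ]
    linarith
  rw [norm_mul, norm_neg, Complex.norm_I, one_mul]
  refine (norm_sub_le _ _).trans ?_
  have k1 := key a b (fun _ => rfl) (fun _ => rfl)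
  have k2 := key (fun m => a m * Complex.exp ((-(Real.log m * T) : ℝ) * Complex.I))
    (fun n => b n * Complex.exp ((Real.log n * T : ℝ) * Complex.I))
    (fun n => by rw [norm_mul, Complex.norm_exp_ofReal_mul_I, mul_one])
    (fun n => by rw [norm_mul, Complex.norm_exp_ofReal_mul_I, mul_one])
  linarith
end

section
/- Let f be analytic on the disc |s − s₀| ≤ r with f(s₀) ≠ 0 and |f(s)/f(s₀)| < e^M for all |s − s₀| ≤ r, where M > 1. Then there is an absolute constant C > 0 such that for all s with |s − s₀| ≤ r/4, |f′(s)/f(s) − ∑_{ρ : |ρ − s₀| ≤ r/2} 1/(s − ρ)| < C·M/r, where the sum runs over the zeros ρ of f in |ρ − s₀| ≤ r/2 counted with multiplicity. -/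
open Metric Set Filter Topology in
/-- Split off the zeros at a finite set of points. -/
lemma titch_factor (f : ℂ → ℂ) (s₀ : ℂ) (r : ℝ) (hr : 0 < r)
    (hf : AnalyticOnNhd ℂ f (closedBall s₀ r)) (h0 : f s₀ ≠ 0) (S : Finset ℂ)
    (hS : ∀ ρ ∈ S, ρ ∈ closedBall s₀ r) :
    ∃ (Z : Multiset ℂ) (g : ℂ → ℂ), AnalyticOnNhd ℂ g (closedBall s₀ r) ∧
      (∀ ρ ∈ Z, ρ ∈ S) ∧ (∀ ρ ∈ S, g ρ ≠ 0) ∧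
      ∀ z, f z = (Z.map (fun ρ => z - ρ)).prod * g z := by
  classical
  induction S using Finset.induction_on with
  | empty => exact ⟨0, f, hf, by simp, by simp, by simp⟩
  | insert a S ha ih =>
    obtain ⟨Z, g, hg, hZ, hgS, hfg⟩ := ih (fun ρ h => hS ρ (Finset.mem_insert_of_mem h))
    have haK : a ∈ closedBall s₀ r := hS a (Finset.mem_insert_self _ _)
    have hg0 : g s₀ ≠ 0 := by
      intro h
      exact h0 (by rw [hfg, h, mul_zero])
    have hne : ¬ ∀ᶠ z in 𝓝 a, g z = 0 := by
      intro h
      have := hg.eqOn_zero_of_preconnected_of_eventuallyEq_zero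
        (convex_closedBall s₀ r).isPreconnected haK h
      exact hg0 (this (mem_closedBall_self hr.le))
    obtain ⟨n, p, hp, hpa, hpe⟩ := (hg a haK).exists_eventuallyEq_pow_smul_nonzero_iff.2 hne
    let G : ℂ → ℂ := fun z => if z = a then p a else g z / (z - a) ^ n
    have hGa : G a = p a := by simp [G]
    have hGz : ∀ z, z ≠ a → G z = g z / (z - a) ^ n := fun z hz => by simp [G, hz]
    refine ⟨Z + Multiset.replicate n a, G, ?_, ?_, ?_, ?_⟩
    · intro z hz
      by_cases hza : z = a
      · subst hza
        refine hp.congr ?_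
        filter_upwards [hpe] with w hw
        by_cases hwz : w = z
        · subst hwz; exact hGa.symm
        · rw [hGz w hwz, hw, smul_eq_mul,
            mul_div_cancel_left₀ _ (pow_ne_zero _ (sub_ne_zero.2 hwz))]
      · have h1 : AnalyticAt ℂ (fun z => g z / (z - a) ^ n) z :=
          (hg z hz).div ((analyticAt_id.sub analyticAt_const).pow n)
            (pow_ne_zero _ (sub_ne_zero.2 hza))
        refine h1.congr ?_
        filter_upwards [isOpen_ne.mem_nhds hza] with w hw
        exact (hGz w hw).symm
    · intro ρ hρ
      rcases Multiset.mem_add.1 hρ with h | h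
      · exact Finset.mem_insert_of_mem (hZ ρ h)
      · rw [Multiset.eq_of_mem_replicate h]; exact Finset.mem_insert_self _ _
    · intro ρ hρ
      by_cases h : ρ = a
      · rw [h, hGa]; exact hpa
      · rw [hGz ρ h]
        exact div_ne_zero (hgS ρ ((Finset.mem_insert.1 hρ).resolve_left h))
          (pow_ne_zero _ (sub_ne_zero.2 h))
    · intro z
      rw [hfg z, Multiset.map_add, Multiset.prod_add, Multiset.map_replicate,
        Multiset.prod_replicate, mul_assoc]
      congr 1
      by_cases h : z = a
      · rw [h, hGa, hpe.self_of_nhds, smul_eq_mul]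
      · rw [hGz z h, mul_div_cancel₀ _ (pow_ne_zero _ (sub_ne_zero.2 h))]

open Metric Set Filter Topology in
lemma titch_finite (f : ℂ → ℂ) (s₀ : ℂ) (r : ℝ) (hr : 0 < r)
    (hf : AnalyticOnNhd ℂ f (closedBall s₀ r)) (h0 : f s₀ ≠ 0) :
    {z | z ∈ closedBall s₀ (r/2) ∧ f z = 0}.Finite := by
  by_contra hinf
  obtain ⟨x, hx, hacc⟩ := Set.Infinite.exists_accPt_of_subset_isCompact hinf
    (isCompact_closedBall s₀ (r/2)) (fun z hz => hz.1)
  rw [accPt_iff_frequently_nhdsNE] at hacc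
  have := hf.eqOn_zero_of_preconnected_of_frequently_eq_zero
    (convex_closedBall s₀ r).isPreconnected (closedBall_subset_closedBall (by linarith) hx)
    (hacc.mono fun z hz => hz.2)
  exact h0 (this (mem_closedBall_self hr.le))

open Metric Set in
/-- Logarithmic derivative bound for a nonvanishing function. -/
lemma titch_nonvanishing (g : ℂ → ℂ) (s₀ : ℂ) (r M : ℝ) (hr : 0 < r) (hM : 1 < M)
    (hg : AnalyticOnNhd ℂ g (closedBall s₀ r))
    (hne : ∀ z ∈ closedBall s₀ (r/2), g z ≠ 0)
    (hb : ∀ z ∈ closedBall s₀ r, ‖g z‖ ≤ Real.exp M * ‖g s₀‖)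
    (s : ℂ) (hs : s ∈ closedBall s₀ (r/4)) : ‖deriv g s / g s‖ ≤ 48 * M / r := by
  have hsub : ball s₀ (r/2) ⊆ closedBall s₀ r :=
    ball_subset_closedBall.trans (closedBall_subset_closedBall (by linarith))
  have hsub2 : ball s₀ (r/2) ⊆ closedBall s₀ (r/2) := ball_subset_closedBall
  have hd : DifferentiableOn ℂ (fun z => deriv g z / g z) (ball s₀ (r/2)) := by
    intro z hz
    exact ((hg z (hsub hz)).deriv.differentiableAt.div (hg z (hsub hz)).differentiableAt
      (hne z (hsub2 hz))).differentiableWithinAt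
  obtain ⟨h, hh0, hh⟩ := hd.isExactOn_ball.with_val_at s₀ 0
  have hs0 : s₀ ∈ ball s₀ (r/2) := mem_ball_self (by linarith)
  have hg0 : g s₀ ≠ 0 := hne s₀ (hsub2 hs0)
  have hder : ∀ z ∈ ball s₀ (r/2), HasDerivAt (fun z => g z * Complex.exp (-h z)) 0 z := by
    intro z hz
    have h1 := (hg z (hsub hz)).differentiableAt.hasDerivAt.mul (hh z hz).neg.cexp
    have h3 := hne z (hsub2 hz)
    have h2 : deriv g z * Complex.exp (-h z) +
        g z * (Complex.exp (-h z) * -(deriv g z / g z)) = 0 := by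
      have : g z * (deriv g z / g z) = deriv g z := mul_div_cancel₀ _ h3
      linear_combination (-Complex.exp (-h z)) * this
    exact h2 ▸ h1
  have hconst : ∀ z ∈ ball s₀ (r/2), g z * Complex.exp (-h z) = g s₀ := by
    intro z hz
    have := isOpen_ball.is_const_of_deriv_eq_zero (convex_ball s₀ (r/2)).isPreconnected
      (fun w hw => (hder w hw).differentiableAt.differentiableWithinAt)
      (fun w hw => (hder w hw).deriv) hz hs0
    simpa [hh0] using this
  have hre : ∀ z ∈ ball s₀ (r/2), (h z).re ≤ M := by
    intro z hz
    have h1 : g z = g s₀ * Complex.exp (h z) := by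
      rw [← hconst z hz, mul_assoc, ← Complex.exp_add]; simp
    have h2 := hb z (hsub hz)
    rw [h1, norm_mul, Complex.norm_exp, mul_comm] at h2
    exact Real.exp_le_exp.1 (le_of_mul_le_mul_right h2 (norm_pos_iff.2 hg0))
  have hbd : ∀ z ∈ closedBall s₀ (3*r/8), ‖h z‖ ≤ 6 * M := by
    intro z hz
    rw [mem_closedBall, dist_eq_norm] at hz
    have hmem : ∀ w ∈ ball (0:ℂ) (r/2), s₀ + w ∈ ball s₀ (r/2) := by
      intro w hw; simpa [dist_eq_norm] using hw
    have hw : z - s₀ ∈ ball (0:ℂ) (r/2) := by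
      rw [mem_ball_zero_iff]; linarith
    have := Complex.borelCaratheodory_zero (f := fun w => h (s₀ + w)) (M := M) (R := r/2)
      (z := z - s₀) (by linarith)
      (fun w hw => ((hh _ (hmem w hw)).comp_const_add s₀ w).differentiableAt.differentiableWithinAt)
      (fun w hw => hre _ (hmem w hw)) (by linarith) hw (by simpa using hh0)
    simp only [add_sub_cancel] at this
    refine this.trans ?_
    rw [div_le_iff₀ (by linarith)]
    nlinarith
  have hsm : s ∈ ball s₀ (r/2) := closedBall_subset_ball (by linarith) hs
  have hcl : closedBall s (r/8) ⊆ closedBall s₀ (3*r/8) := by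
    apply closedBall_subset_closedBall'
    rw [mem_closedBall] at hs; linarith
  have hcl2 : closedBall s (r/8) ⊆ ball s₀ (r/2) :=
    hcl.trans (closedBall_subset_ball (by linarith))
  have := Complex.norm_deriv_le_of_forall_mem_sphere_norm_le (c := s) (R := r/8) (C := 6 * M)
    (f := h) (by linarith)
    (DifferentiableOn.diffContOnCl (by
      rw [closure_ball _ (by linarith)]
      exact fun w hw => (hh w (hcl2 hw)).differentiableAt.differentiableWithinAt))
    (fun z hz => hbd z (hcl (sphere_subset_closedBall hz)))
  rw [(hh s hsm).deriv] at this
  refine this.trans (le_of_eq ?_)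
  field_simp
  norm_num

lemma titch_prod_ne (Z : Multiset ℂ) (s : ℂ) (h : (Z.map (fun ρ => s - ρ)).prod ≠ 0) :
    DifferentiableAt ℂ (fun z => (Z.map (fun ρ => z - ρ)).prod) s ∧
    logDeriv (fun z => (Z.map (fun ρ => z - ρ)).prod) s = (Z.map (fun ρ => 1 / (s - ρ))).sum := by
  induction Z using Multiset.induction_on with
  | empty => simp [logDeriv_apply]
  | cons a Z ih =>
    simp only [Multiset.map_cons, Multiset.prod_cons, Multiset.sum_cons] at h ⊢
    obtain ⟨h1, h2⟩ := ih (right_ne_zero_of_mul h)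
    refine ⟨(by fun_prop : DifferentiableAt ℂ (fun z => z - a) s).mul h1, ?_⟩
    rw [logDeriv_mul s (left_ne_zero_of_mul h) (right_ne_zero_of_mul h) (by fun_prop) h1, h2]
    simp [logDeriv_apply]

/-- Titchmarsh's lemma: if `f` is analytic on `|s − s₀| ≤ r`, `f(s₀) ≠ 0` and
`|f(s)/f(s₀)| < e^M` there, then `f′/f` is approximated, within `C·M/r` for an
absolute constant `C`, by the sum of `1/(s − ρ)` over the zeros `ρ` of `f`
(with multiplicity) in `|ρ − s₀| ≤ r/2`, uniformly for `|s − s₀| ≤ r/4`. -/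
theorem stmt_11 : ∃ C : ℝ, 0 < C ∧
    ∀ (f : ℂ → ℂ) (s₀ : ℂ) (r M : ℝ), 0 < r → 1 < M →
      AnalyticOnNhd ℂ f (Metric.closedBall s₀ r) →
      f s₀ ≠ 0 →
      (∀ s ∈ Metric.closedBall s₀ r, ‖f s / f s₀‖ < Real.exp M) →
      ∃ Z : Multiset ℂ,
        (∀ ρ ∈ Z, ρ ∈ Metric.closedBall s₀ (r/2) ∧ f ρ = 0) ∧
        (∀ ρ ∈ Metric.closedBall s₀ (r/2), f ρ = 0 → ρ ∈ Z) ∧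
        ∀ s ∈ Metric.closedBall s₀ (r/4), f s ≠ 0 →
          ‖deriv f s / f s - (Z.map (fun ρ => 1 / (s - ρ))).sum‖ < C * M / r := by
  refine ⟨49, by norm_num, ?_⟩
  intro f s₀ r M hr hM hf h0 hb
  have hfin := titch_finite f s₀ r hr hf h0
  obtain ⟨Z, g, hg, hZ, hgS, hfg⟩ := titch_factor f s₀ r hr hf h0 hfin.toFinset (by
    intro ρ hρ
    rw [Set.Finite.mem_toFinset] at hρ
    exact Metric.closedBall_subset_closedBall (by linarith) hρ.1)
  have hZ' : ∀ ρ ∈ Z, ρ ∈ Metric.closedBall s₀ (r/2) ∧ f ρ = 0 := by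
    intro ρ hρ
    exact (Set.Finite.mem_toFinset hfin).1 (hZ ρ hρ)
  have hgne : ∀ z ∈ Metric.closedBall s₀ (r/2), g z ≠ 0 := by
    intro z hz h
    have : f z = 0 := by rw [hfg, h, mul_zero]
    exact hgS z ((Set.Finite.mem_toFinset hfin).2 ⟨hz, this⟩) h
  refine ⟨Z, hZ', ?_, ?_⟩
  · intro ρ hρ hfρ
    rw [hfg ρ] at hfρ
    have h1 := (mul_eq_zero.1 hfρ).resolve_right (hgne ρ hρ)
    rw [Multiset.prod_eq_zero_iff, Multiset.mem_map] at h1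
    obtain ⟨a, ha, hae⟩ := h1
    rwa [sub_eq_zero.1 hae]
  · intro s hs hfs
    have hsr : s ∈ Metric.closedBall s₀ r := Metric.closedBall_subset_closedBall (by linarith) hs
    have hnorm : ∀ z, ‖(Z.map (fun ρ => z - ρ)).prod‖ = (Z.map (fun ρ => ‖z - ρ‖)).prod := by
      intro z
      have := map_multiset_prod (normHom : ℂ →*₀ ℝ) (Z.map (fun ρ => z - ρ))
      rw [Multiset.map_map] at this
      exact this
    have hbs : ∀ z ∈ Metric.sphere s₀ r, ‖g z‖ ≤ Real.exp M * ‖g s₀‖ := by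
      intro z hz
      have hz' := hb z (Metric.sphere_subset_closedBall hz)
      rw [norm_div, div_lt_iff₀ (norm_pos_iff.2 h0), hfg z, hfg s₀, norm_mul, norm_mul,
        hnorm, hnorm] at hz'
      rw [mem_sphere_iff_norm] at hz
      have hle : ∀ ρ ∈ Z, ‖s₀ - ρ‖ ≤ ‖z - ρ‖ ∧ 0 < ‖z - ρ‖ := by
        intro ρ hρ
        have h1 := (hZ' ρ hρ).1
        rw [mem_closedBall_iff_norm] at h1
        have h2 : ‖z - s₀‖ ≤ ‖z - ρ‖ + ‖ρ - s₀‖ := norm_sub_le_norm_sub_add_norm_sub z ρ s₀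
        rw [norm_sub_rev s₀ ρ]
        constructor <;> linarith
      have hP : (Z.map (fun ρ => ‖s₀ - ρ‖)).prod ≤ (Z.map (fun ρ => ‖z - ρ‖)).prod :=
        Multiset.prod_map_le_prod_map₀ _ _ (fun _ _ => norm_nonneg _) (fun ρ hρ => (hle ρ hρ).1)
      have hpos : 0 < (Z.map (fun ρ => ‖z - ρ‖)).prod := by
        apply Multiset.prod_pos
        intro a ha
        obtain ⟨ρ, hρ, rfl⟩ := Multiset.mem_map.1 ha
        exact (hle ρ hρ).2
      refine le_of_mul_le_mul_left ?_ hpos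
      calc _ ≤ _ := hz'.le
        _ = (Z.map (fun ρ => ‖s₀ - ρ‖)).prod * (Real.exp M * ‖g s₀‖) := by ring
        _ ≤ _ := mul_le_mul_of_nonneg_right hP (by positivity)
    have hbg : ∀ z ∈ Metric.closedBall s₀ r, ‖g z‖ ≤ Real.exp M * ‖g s₀‖ := by
      intro z hz
      refine Complex.norm_le_of_forall_mem_frontier_norm_le (U := Metric.ball s₀ r)
        Metric.isBounded_ball (DifferentiableOn.diffContOnCl ?_) ?_ ?_
      · rw [closure_ball _ hr.ne']; exact hg.differentiableOn
      · rw [frontier_ball _ hr.ne']; exact hbs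
      · rwa [closure_ball _ hr.ne']
    have hmain := titch_nonvanishing g s₀ r M hr hM hg hgne hbg s hs
    have hfs' := hfs
    rw [hfg s] at hfs'
    obtain ⟨hd, hl⟩ := titch_prod_ne Z s (left_ne_zero_of_mul hfs')
    have hkey : deriv f s / f s = (Z.map (fun ρ => 1 / (s - ρ))).sum + deriv g s / g s := by
      have := logDeriv_mul s (left_ne_zero_of_mul hfs') (right_ne_zero_of_mul hfs') hd
        (hg s hsr).differentiableAt
      rw [hl, ← funext hfg] at this
      exact this
    rw [hkey, add_sub_cancel_left]
    refine hmain.trans_lt ?_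
    gcongr
    norm_num
end
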